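/- Let q be a real number with 0 < q < 1 and let m be a positive rational number. Then ∑_{i,j,k ≥ 0} q^{2m(i−j)² + (i+j)² + 2k² − 2(i+j)k + i − j + 2k} / ((q⁴;q⁴)_i (q⁴;q⁴)_j (q⁴;q⁴)_k) = J_8² J̄_{8m+2, 16m+4} / J_4³ + q^{2m} J_4³ J_{32m+8}² / (J_2² J_8² J_{16m+4}). -/

import Mathlib

open scoped BigOperators Topology Real

/-- Finite q-Pochhammer symbol `(a;q)_n = ∏_{k=0}^{n-1} (1 - a q^k)`. -/
noncomputable def qPochFinR (a q : ℝ) (n : ℕ) : ℝ := ∏ k ∈ Finset.range n, (1 - a * q ^ k)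

/-- Infinite q-Pochhammer symbol `(a;q)_∞ = ∏_{k=0}^{∞} (1 - a q^k)`. -/
noncomputable def qPochInfR (a q : ℝ) : ℝ := ∏' k : ℕ, (1 - a * q ^ k)

/-- `J_m = (q^m; q^m)_∞` with `q^m` the real power of `q`. -/
noncomputable def JR (q m : ℝ) : ℝ := qPochInfR (q ^ m) (q ^ m)

/-- `J_{a,m} = (q^a;q^m)_∞ (q^{m-a};q^m)_∞ (q^m;q^m)_∞` with real powers of `q`. -/
noncomputable def JamR (q a m : ℝ) : ℝ :=
  qPochInfR (q ^ a) (q ^ m) * qPochInfR (q ^ (m - a)) (q ^ m) * qPochInfR (q ^ m) (q ^ m)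

/-- `J̄_{a,m} = (-q^a;q^m)_∞ (-q^{m-a};q^m)_∞ (q^m;q^m)_∞` with real powers of `q`. -/
noncomputable def JbarR (q a m : ℝ) : ℝ :=
  qPochInfR (-(q ^ a)) (q ^ m) * qPochInfR (-(q ^ (m - a))) (q ^ m) * qPochInfR (q ^ m) (q ^ m)

open Filter Finset

section QPochhammer

variable {q : ℝ}

theorem qPochFinR_succ (a q : ℝ) (n : ℕ) :
    qPochFinR a q (n + 1) = qPochFinR a q n * (1 - a * q ^ n) :=
  prod_range_succ _ _

theorem qPochFinR_add (a q : ℝ) (m n : ℕ) :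
    qPochFinR a q (m + n) = qPochFinR a q m * qPochFinR (a * q ^ m) q n := by
  simp only [qPochFinR, prod_range_add, pow_add, mul_assoc]

theorem qPochFinR_succ' (a q : ℝ) (n : ℕ) :
    qPochFinR a q (n + 1) = (1 - a) * qPochFinR (a * q) q n := by
  rw [add_comm, qPochFinR_add]
  simp [qPochFinR]

theorem multipliable_qPoch (hq0 : 0 < q) (hq1 : q < 1) (a : ℝ) :
    Multipliable fun k : ℕ => 1 - a * q ^ k := by
  simpa only [sub_eq_add_neg] using Real.multipliable_one_add_of_summable
    ((summable_geometric_of_lt_one hq0.le hq1).mul_left a).neg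

theorem qPochInfR_eq_fin_mul (hq0 : 0 < q) (hq1 : q < 1) (a : ℝ) (n : ℕ) :
    qPochInfR a q = qPochFinR a q n * qPochInfR (a * q ^ n) q := by
  have h : ∀ k, 1 - a * q ^ n * q ^ k = 1 - a * q ^ (k + n) := fun k => by ring
  simp only [qPochInfR, qPochFinR, h]
  refine (Multipliable.prod_mul_tprod_nat_mul' ?_).symm
  simpa only [← h] using multipliable_qPoch hq0 hq1 (a * q ^ n)

theorem qPochInfR_eq_mul (hq0 : 0 < q) (hq1 : q < 1) (a : ℝ) :
    qPochInfR a q = (1 - a) * qPochInfR (a * q) q := by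
  simpa [qPochFinR] using qPochInfR_eq_fin_mul hq0 hq1 a 1

theorem tendsto_qPochFinR (hq0 : 0 < q) (hq1 : q < 1) (a : ℝ) :
    Tendsto (qPochFinR a q) atTop (𝓝 (qPochInfR a q)) :=
  (multipliable_qPoch hq0 hq1 a).hasProd.tendsto_prod_nat

theorem one_sub_mul_pow_pos (hq0 : 0 < q) (hq1 : q < 1) {a : ℝ} (ha : a < 1) (n : ℕ) :
    0 < 1 - a * q ^ n := by
  have h1 : q ^ n ≤ 1 := pow_le_one₀ hq0.le hq1.le
  have h0 : 0 < q ^ n := pow_pos hq0 n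
  nlinarith

theorem qPochFinR_pos (hq0 : 0 < q) (hq1 : q < 1) {a : ℝ} (ha : a < 1) (n : ℕ) :
    0 < qPochFinR a q n :=
  prod_pos fun k _ => one_sub_mul_pow_pos hq0 hq1 ha k

theorem qPochInfR_pos (hq0 : 0 < q) (hq1 : q < 1) {a : ℝ} (ha : a < 1) :
    0 < qPochInfR a q := by
  rw [qPochInfR, ← Real.rexp_tsum_eq_tprod (one_sub_mul_pow_pos hq0 hq1 ha)]
  · exact Real.exp_pos _
  · simpa only [sub_eq_add_neg] using Real.summable_log_one_add_of_summable
      ((summable_geometric_of_lt_one hq0.le hq1).mul_left a).neg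

theorem qPochInfR_le_fin (hq0 : 0 < q) (hq1 : q < 1) {a : ℝ} (ha0 : 0 ≤ a) (ha : a < 1) (n : ℕ) :
    qPochInfR a q ≤ qPochFinR a q n := by
  refine Antitone.le_of_tendsto (antitone_nat_of_succ_le fun k => ?_)
    (tendsto_qPochFinR hq0 hq1 a) n
  rw [qPochFinR_succ]
  refine mul_le_of_le_one_right (qPochFinR_pos hq0 hq1 ha k).le ?_
  have : 0 ≤ a * q ^ k := by positivity
  linarith

theorem qPochFinR_anti (hq0 : 0 < q) (hq1 : q < 1) {a b : ℝ} (hab : a ≤ b) (hb : b < 1) (n : ℕ) :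
    qPochFinR b q n ≤ qPochFinR a q n := by
  refine prod_le_prod (fun k _ => (one_sub_mul_pow_pos hq0 hq1 hb k).le) fun k _ => ?_
  gcongr

theorem qPochInfR_mul_neg (hq0 : 0 < q) (hq1 : q < 1) (a : ℝ) :
    qPochInfR a q * qPochInfR (-a) q = qPochInfR (a ^ 2) (q ^ 2) := by
  rw [qPochInfR, qPochInfR, ← Multipliable.tprod_mul (multipliable_qPoch hq0 hq1 a)
    (multipliable_qPoch hq0 hq1 (-a)), qPochInfR]
  exact tprod_congr fun k => by ring

theorem qPochInfR_sq_mul (hq0 : 0 < q) (hq1 : q < 1) (a : ℝ) :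
    qPochInfR a (q ^ 2) * qPochInfR (a * q) (q ^ 2) = qPochInfR a q := by
  have hq2 : q ^ 2 < 1 := pow_lt_one₀ hq0.le hq1 two_ne_zero
  have h0 : ∀ k, 1 - a * (q ^ 2) ^ k = 1 - a * q ^ (2 * k) := fun k => by ring
  have h1 : ∀ k, 1 - a * q * (q ^ 2) ^ k = 1 - a * q ^ (2 * k + 1) := fun k => by ring
  have m0 := multipliable_qPoch (pow_pos hq0 2) hq2 a
  have m1 := multipliable_qPoch (pow_pos hq0 2) hq2 (a * q)
  simp only [h0, h1] at m0 m1
  simp only [qPochInfR, h0, h1]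
  exact tprod_even_mul_odd (f := fun k => 1 - a * q ^ k) m0 m1

theorem choose_two_succ (n : ℕ) : (n + 1).choose 2 = n.choose 2 + n := by
  rw [Nat.choose_succ_succ' n 1, Nat.choose_one_right, add_comm]

theorem two_mul_choose_two (n : ℕ) : 2 * n.choose 2 + n = n ^ 2 := by
  induction n with
  | zero => rfl
  | succ n ih => rw [choose_two_succ]; linarith

theorem summable_pow_choose_two_mul_pow (hq0 : 0 < q) (hq1 : q < 1) (c : ℝ) :
    Summable fun j : ℕ => q ^ j.choose 2 * c ^ j := by
  rcases eq_or_ne c 0 with rfl | hc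
  · exact summable_of_ne_finset_zero (s := {0}) fun j hj => by
      simp [zero_pow (Finset.notMem_singleton.1 hj)]
  have hne : ∀ j : ℕ, q ^ j.choose 2 * c ^ j ≠ 0 := fun j =>
    mul_ne_zero (pow_ne_zero _ hq0.ne') (pow_ne_zero _ hc)
  refine summable_of_ratio_test_tendsto_lt_one zero_lt_one (Eventually.of_forall hne) ?_
  have h := (tendsto_pow_atTop_nhds_zero_of_lt_one hq0.le hq1).mul_const |c|
  rw [zero_mul] at h
  refine h.congr fun j => ?_
  rw [← norm_div, choose_two_succ, ← Real.norm_eq_abs c, ← Real.norm_of_nonneg (pow_pos hq0 j).le,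
    ← norm_mul]
  congr 1
  rw [eq_div_iff (hne j)]
  ring

/-- The general term of the basic hypergeometric series `₁φ₁`, in homogeneous form. -/
noncomputable def phiTerm (q x a b : ℝ) (j : ℕ) : ℝ :=
  (∏ l ∈ range j, (x + a * q ^ l)) * q ^ j.choose 2 * b ^ j /
    (qPochFinR q q j * qPochFinR (a * b) q j)

theorem phiTerm_nonneg (hq0 : 0 < q) (hq1 : q < 1) {x a b : ℝ} (hx : 0 ≤ x) (ha : 0 ≤ a)
    (hb : 0 ≤ b) (hab : a * b < 1) (j : ℕ) : 0 ≤ phiTerm q x a b j := by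
  have := qPochFinR_pos hq0 hq1 hab j
  have := qPochFinR_pos hq0 hq1 hq1 j
  have : 0 ≤ ∏ l ∈ range j, (x + a * q ^ l) := prod_nonneg fun l _ => by positivity
  unfold phiTerm
  positivity

theorem phiTerm_le (hq0 : 0 < q) (hq1 : q < 1) {x a a' b b' : ℝ} (hx : 0 ≤ x) (ha : 0 ≤ a)
    (haa : a ≤ a') (hb : 0 ≤ b) (hbb : b ≤ b') (hab : a' * b' < 1) (j : ℕ) :
    phiTerm q x a b j ≤
      q ^ j.choose 2 * ((x + a') * b') ^ j / (qPochInfR q q * qPochInfR (a' * b') q) := by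
  have ha' : 0 ≤ a' := ha.trans haa
  have hb' : 0 ≤ b' := hb.trans hbb
  have hle : a * b ≤ a' * b' := by gcongr
  have h1 := qPochInfR_pos hq0 hq1 hab
  have h2 := qPochInfR_pos hq0 hq1 hq1
  have hpr : ∏ l ∈ range j, (x + a * q ^ l) ≤ (x + a') ^ j := by
    refine (prod_le_prod (fun l _ => by positivity) (g := fun _ => x + a') fun l _ => ?_).trans_eq
      (by simp)
    have : q ^ l ≤ 1 := pow_le_one₀ hq0.le hq1.le
    nlinarith
  have hpr0 : 0 ≤ ∏ l ∈ range j, (x + a * q ^ l) := prod_nonneg fun l _ => by positivity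
  have h3 := qPochInfR_le_fin hq0 hq1 hq0.le hq1 j
  have h4 := (qPochInfR_le_fin hq0 hq1 (mul_nonneg ha' hb') hab j).trans
    (qPochFinR_anti hq0 hq1 hle hab j)
  have h5 := h2.trans_le h3
  calc phiTerm q x a b j ≤ (x + a') ^ j * q ^ j.choose 2 * b' ^ j /
        (qPochInfR q q * qPochInfR (a' * b') q) := by
        unfold phiTerm; gcongr
    _ = _ := by rw [mul_pow]; ring

theorem summable_phiTerm (hq0 : 0 < q) (hq1 : q < 1) {x a b : ℝ} (hx : 0 ≤ x) (ha : 0 ≤ a)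
    (hb : 0 ≤ b) (hab : a * b < 1) : Summable (phiTerm q x a b) :=
  Summable.of_nonneg_of_le (phiTerm_nonneg hq0 hq1 hx ha hb hab)
    (phiTerm_le hq0 hq1 hx ha le_rfl hb le_rfl hab)
    ((summable_pow_choose_two_mul_pow hq0 hq1 _).div_const _)

theorem tendsto_tsum_phiTerm (hq0 : 0 < q) (hq1 : q < 1) {x a b : ℝ} (hx : 0 ≤ x)
    {u v : ℕ → ℝ} {u' v' : ℝ} (hu : Tendsto u atTop (𝓝 u')) (hv : Tendsto v atTop (𝓝 v'))
    (hu0 : ∀ n, 0 ≤ u n) (hv0 : ∀ n, 0 ≤ v n) (hua : ∀ n, u n ≤ a) (hvb : ∀ n, v n ≤ b)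
    (hab : a * b < 1) :
    Tendsto (fun n => ∑' j, phiTerm q x (u n) (v n) j) atTop (𝓝 (∑' j, phiTerm q x u' v' j)) := by
  have hlt : ∀ n, u n * v n < 1 := fun n =>
    (mul_le_mul (hua n) (hvb n) (hv0 n) ((hu0 n).trans (hua n))).trans_lt hab
  have hlt' : u' * v' < 1 := (le_of_tendsto' (hu.mul hv) fun n =>
    mul_le_mul (hua n) (hvb n) (hv0 n) ((hu0 n).trans (hua n))).trans_lt hab
  refine tendsto_tsum_of_dominated_convergence
    ((summable_pow_choose_two_mul_pow hq0 hq1 ((x + a) * b)).div_const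
      (qPochInfR q q * qPochInfR (a * b) q)) (fun j => ?_) (Eventually.of_forall fun n j => ?_)
  · have hd : Tendsto (fun n => qPochFinR (u n * v n) q j) atTop (𝓝 (qPochFinR (u' * v') q j)) :=
      tendsto_finsetProd _ fun l _ => ((hu.mul hv).mul_const _).const_sub _
    have hp : Tendsto (fun n => ∏ l ∈ range j, (x + u n * q ^ l)) atTop
        (𝓝 (∏ l ∈ range j, (x + u' * q ^ l))) :=
      tendsto_finsetProd _ fun l _ => (hu.mul_const _).const_add _
    exact ((hp.mul_const _).mul (hv.pow j)).div (hd.const_mul _)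
      (mul_pos (qPochFinR_pos hq0 hq1 hq1 j) (qPochFinR_pos hq0 hq1 hlt' j)).ne'
  · rw [Real.norm_of_nonneg (phiTerm_nonneg hq0 hq1 hx (hu0 n) (hv0 n) (hlt n) j)]
    exact phiTerm_le hq0 hq1 hx (hu0 n) (hua n) (hv0 n) (hvb n) hab j

theorem phiTerm_succ_left (hq0 : 0 < q) (hq1 : q < 1) {x a b : ℝ} (hab : a * b < 1) (n : ℕ) :
    (1 - a * b) * phiTerm q x a b (n + 1) * (1 - q ^ (n + 1)) =
      phiTerm q x (a * q) b n * (x + a) * q ^ n * b := by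
  have h1 := (qPochFinR_pos hq0 hq1 hq1 n).ne'
  have h2 : qPochFinR (a * q * b) q n ≠ 0 := by
    have := qPochFinR_pos hq0 hq1 hab (n + 1)
    rw [qPochFinR_succ', mul_right_comm] at this
    exact right_ne_zero_of_mul this.ne'
  have h3 : 1 - q * q ^ n ≠ 0 := (one_sub_mul_pow_pos hq0 hq1 hq1 n).ne'
  have h4 : 1 - a * b ≠ 0 := by linarith
  have h5 : ∏ l ∈ range (n + 1), (x + a * q ^ l) =
      (x + a) * ∏ l ∈ range n, (x + a * q * q ^ l) := by
    rw [prod_range_succ', mul_comm]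
    simp only [pow_zero, mul_one, pow_succ', mul_assoc]
  rw [phiTerm, phiTerm, h5, choose_two_succ, qPochFinR_succ q, qPochFinR_succ' (a * b),
    mul_right_comm a b q]
  field_simp
  ring

theorem phiTerm_succ_right (hq0 : 0 < q) (hq1 : q < 1) {x a b : ℝ} (hab : a * b < 1) (n : ℕ) :
    phiTerm q x a b (n + 1) * (1 - q ^ (n + 1)) * (1 - a * b * q ^ n) =
      phiTerm q x a b n * (x + a * q ^ n) * q ^ n * b := by
  have h1 := (qPochFinR_pos hq0 hq1 hq1 n).ne'
  have h2 := (qPochFinR_pos hq0 hq1 hab n).ne'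
  have h3 : 1 - q * q ^ n ≠ 0 := (one_sub_mul_pow_pos hq0 hq1 hq1 n).ne'
  have h4 : 1 - a * b * q ^ n ≠ 0 := (one_sub_mul_pow_pos hq0 hq1 hab n).ne'
  rw [phiTerm, phiTerm, prod_range_succ, choose_two_succ, qPochFinR_succ q,
    qPochFinR_succ (a * b), mul_assoc, div_mul_eq_mul_div, mul_assoc (_ / _), mul_assoc (_ / _),
    div_mul_eq_mul_div, div_eq_div_iff (mul_ne_zero (mul_ne_zero h1 h3) (mul_ne_zero h2 h4))
    (mul_ne_zero h1 h2)]
  ring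

theorem sum_range_phiTerm_sub (hq0 : 0 < q) (hq1 : q < 1) {x a b : ℝ} (ha : 0 ≤ a) (hb : 0 ≤ b)
    (hab : a * b < 1) (n : ℕ) :
    ∑ j ∈ range (n + 1), ((1 - a * b) * phiTerm q x a b j - phiTerm q x (a * q) b j) =
      -(a * b * q ^ n * phiTerm q x (a * q) b n) := by
  have hab' : a * q * b < 1 := by
    have : a * b * q ≤ a * b := mul_le_of_le_one_right (mul_nonneg ha hb) hq1.le
    linarith
  induction n with
  | zero => simp [phiTerm, qPochFinR]
  | succ n ih =>
    rw [sum_range_succ, ih]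
    have h3 : 1 - q ^ (n + 1) ≠ 0 := by
      rw [pow_succ']; exact (one_sub_mul_pow_pos hq0 hq1 hq1 n).ne'
    have h4 : 1 - a * q * b * q ^ n ≠ 0 := (one_sub_mul_pow_pos hq0 hq1 hab' n).ne'
    have e1 := phiTerm_succ_left hq0 hq1 (x := x) hab n
    have e2 := phiTerm_succ_right hq0 hq1 (x := x) hab' n
    obtain ⟨w, hw⟩ : ∃ w, phiTerm q x (a * q) b n =
        w * ((1 - q ^ (n + 1)) * (1 - a * q * b * q ^ n)) :=
      ⟨_, (div_mul_cancel₀ _ (mul_ne_zero h3 h4)).symm⟩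
    rw [hw] at e1 e2 ⊢
    have e1' : (1 - a * b) * phiTerm q x a b (n + 1) =
        w * (1 - a * q * b * q ^ n) * (x + a) * q ^ n * b :=
      mul_right_cancel₀ h3 (by linear_combination e1)
    have e2' : phiTerm q x (a * q) b (n + 1) = w * (x + a * q * q ^ n) * q ^ n * b :=
      mul_right_cancel₀ h3 (mul_right_cancel₀ h4 (by linear_combination e2))
    rw [e1', e2']
    ring

theorem tsum_phiTerm_mul_left (hq0 : 0 < q) (hq1 : q < 1) {x a b : ℝ} (hx : 0 ≤ x) (ha : 0 ≤ a)
    (hb : 0 ≤ b) (hab : a * b < 1) :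
    (1 - a * b) * ∑' j, phiTerm q x a b j = ∑' j, phiTerm q x (a * q) b j := by
  have hab' : a * q * b < 1 := by
    have : a * b * q ≤ a * b := mul_le_of_le_one_right (mul_nonneg ha hb) hq1.le
    linarith
  have s1 := (summable_phiTerm hq0 hq1 hx ha hb hab).mul_left (1 - a * b)
  have s2 := summable_phiTerm hq0 hq1 hx (mul_nonneg ha hq0.le) hb hab'
  rw [← tsum_mul_left, ← sub_eq_zero, ← s1.tsum_sub s2]
  refine tendsto_nhds_unique ((tendsto_add_atTop_iff_nat 1).2
    (s1.sub s2).hasSum.tendsto_sum_nat) ?_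
  simp only [sum_range_phiTerm_sub hq0 hq1 ha hb hab]
  simpa using ((((tendsto_pow_atTop_nhds_zero_of_lt_one hq0.le hq1).const_mul (a * b)).mul
    s2.tendsto_atTop_zero)).neg

theorem tsum_phiTerm_zero_mul (hq0 : 0 < q) (hq1 : q < 1) {b : ℝ} (hb : 0 ≤ b) :
    ∑' j, phiTerm q 1 0 b j = (1 + b) * ∑' j, phiTerm q 1 0 (b * q) j := by
  have s1 := summable_phiTerm hq0 hq1 zero_le_one le_rfl hb (by simp)
  have s2 := summable_phiTerm hq0 hq1 zero_le_one le_rfl (mul_nonneg hb hq0.le) (by simp)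
  have h : ∀ j, phiTerm q 1 0 b (j + 1) - phiTerm q 1 0 (b * q) (j + 1) =
      b * phiTerm q 1 0 (b * q) j := fun j => by
    have h1 := (qPochFinR_pos hq0 hq1 hq1 j).ne'
    have h3 : 1 - q * q ^ j ≠ 0 := (one_sub_mul_pow_pos hq0 hq1 hq1 j).ne'
    simp only [phiTerm, choose_two_succ, qPochFinR_succ q]
    simp [qPochFinR] at *
    field_simp
    ring
  have : ∑' j, phiTerm q 1 0 b j - ∑' j, phiTerm q 1 0 (b * q) j =
      b * ∑' j, phiTerm q 1 0 (b * q) j := by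
    rw [← s1.tsum_sub s2, (s1.sub s2).tsum_eq_zero_add, ← tsum_mul_left]
    simp only [h]
    simp [phiTerm]
  linarith

theorem tsum_phiTerm_zero (hq0 : 0 < q) (hq1 : q < 1) {b : ℝ} (hb : 0 ≤ b) :
    ∑' j, phiTerm q 1 0 b j = qPochInfR (-b) q := by
  have h : ∀ n : ℕ, ∑' j, phiTerm q 1 0 b j =
      qPochFinR (-b) q n * ∑' j, phiTerm q 1 0 (b * q ^ n) j := fun n => by
    induction n with
    | zero => simp [qPochFinR]
    | succ n ih =>
      rw [ih, tsum_phiTerm_zero_mul hq0 hq1 (by positivity), qPochFinR_succ, pow_succ]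
      ring_nf
  have hp := tendsto_pow_atTop_nhds_zero_of_lt_one hq0.le hq1
  have ht := (tendsto_qPochFinR hq0 hq1 (-b)).mul (tendsto_tsum_phiTerm hq0 hq1 zero_le_one
    (u := fun _ => 0) tendsto_const_nhds (hp.const_mul b) (fun _ => le_rfl)
    (fun n => by positivity) (fun _ => le_rfl)
    (fun n => mul_le_of_le_one_right hb (pow_le_one₀ hq0.le hq1.le)) (by simp))
  simp only [← h] at ht
  rw [tendsto_nhds_unique tendsto_const_nhds ht, mul_zero, tsum_eq_single 0]
  · simp [phiTerm, qPochFinR]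
  · intro j hj
    simp [phiTerm, hj]

/-- Euler's second `q`-exponential identity. -/
theorem hasSum_euler (hq0 : 0 < q) (hq1 : q < 1) {b : ℝ} (hb : 0 ≤ b) :
    HasSum (fun j : ℕ => q ^ j.choose 2 * b ^ j / qPochFinR q q j) (qPochInfR (-b) q) := by
  have := (summable_phiTerm hq0 hq1 zero_le_one le_rfl hb (by simp)).hasSum
  rw [tsum_phiTerm_zero hq0 hq1 hb] at this
  refine this.congr_fun ?_
  intro j
  simp [phiTerm, qPochFinR]

/-- The `₁φ₁` summation formula, in homogeneous form. -/
theorem hasSum_phiTerm (hq0 : 0 < q) (hq1 : q < 1) {x a b : ℝ} (hx : 0 ≤ x) (ha : 0 ≤ a)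
    (hb : 0 ≤ b) (hab : a * b < 1) :
    HasSum (phiTerm q x a b) (qPochInfR (-(x * b)) q / qPochInfR (a * b) q) := by
  have hle : ∀ n : ℕ, a * q ^ n ≤ a := fun n =>
    mul_le_of_le_one_right ha (pow_le_one₀ hq0.le hq1.le)
  have hlt : ∀ n : ℕ, a * q ^ n * b < 1 := fun n =>
    (mul_le_mul_of_nonneg_right (hle n) hb).trans_lt hab
  have h : ∀ n : ℕ, qPochFinR (a * b) q n * ∑' j, phiTerm q x a b j =
      ∑' j, phiTerm q x (a * q ^ n) b j := fun n => by
    induction n with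
    | zero => simp [qPochFinR]
    | succ n ih =>
      rw [pow_succ, ← mul_assoc, ← tsum_phiTerm_mul_left hq0 hq1 hx (by positivity) hb (hlt n),
        ← ih, qPochFinR_succ]
      ring
  have hp := tendsto_pow_atTop_nhds_zero_of_lt_one hq0.le hq1
  have ht := tendsto_tsum_phiTerm hq0 hq1 hx (hp.const_mul a)
    (v := fun _ => b) tendsto_const_nhds (fun n => by positivity) (fun _ => hb)
    hle (fun _ => le_rfl) hab
  simp only [← h, mul_zero] at ht
  have he := tendsto_nhds_unique ((tendsto_qPochFinR hq0 hq1 (a * b)).mul_const _) ht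
  have h0 : ∑' j, phiTerm q x 0 b j = qPochInfR (-(x * b)) q := by
    rw [← tsum_phiTerm_zero hq0 hq1 (mul_nonneg hx hb)]
    refine tsum_congr fun j => ?_
    simp [phiTerm, qPochFinR, mul_pow]
    ring
  rw [h0] at he
  rw [← he, mul_div_cancel_left₀ _ (qPochInfR_pos hq0 hq1 hab).ne']
  exact (summable_phiTerm hq0 hq1 hx ha hb hab).hasSum

end QPochhammer

theorem HasSum.congr_of_eq {ι α : Type*} [AddCommMonoid α] [TopologicalSpace α] {f g : ι → α}
    {a b : α} (h : HasSum f a) (hf : ∀ i, g i = f i) (ha : b = a) : HasSum g b := by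
  rwa [funext hf, ha]

section JacobiTripleProduct

variable {q : ℝ}

theorem hasSum_phiTerm_shift (hq0 : 0 < q) (hq1 : q < 1) {x a b : ℝ} (hx : 0 ≤ x) (ha : 0 ≤ a)
    (hb : 0 ≤ b) {m : ℕ} (hab : a * b = q ^ (m + 1)) :
    HasSum (fun k : ℕ => (∏ l ∈ range k, (x + a * q ^ l)) * q ^ k.choose 2 * b ^ k /
      (qPochFinR q q k * qPochFinR q q (k + m))) (qPochInfR (-(x * b)) q / qPochInfR q q) := by
  have hlt : a * b < 1 := hab ▸ pow_lt_one₀ hq0.le hq1 m.succ_ne_zero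
  have h := (hasSum_phiTerm hq0 hq1 hx ha hb hlt).div_const (qPochFinR q q m)
  have e : a * b = q * q ^ m := by rw [hab, pow_succ']
  refine h.congr_of_eq (fun k => ?_) ?_
  · rw [phiTerm, add_comm k m, qPochFinR_add q q m k, e, div_div]
    ring
  · rw [qPochInfR_eq_fin_mul hq0 hq1 q m, e, div_div, mul_comm (qPochFinR q q m)]

/-- Cauchy's identity for the Durfee rectangle. -/
theorem hasSum_durfee (hq0 : 0 < q) (hq1 : q < 1) (m : ℕ) :
    HasSum (fun k : ℕ => q ^ (k ^ 2 + k * m) / (qPochFinR q q k * qPochFinR q q (k + m)))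
      (1 / qPochInfR q q) := by
  have h := hasSum_phiTerm_shift hq0 hq1 le_rfl zero_le_one (pow_pos hq0 (m + 1)).le (m := m)
    (one_mul _)
  refine h.congr_of_eq (fun k => ?_) ?_
  · simp only [zero_add, one_mul]
    rw [prod_pow_eq_pow_sum (range k) (fun l => l) q, sum_range_id, ← Nat.choose_two_right,
      ← pow_mul, ← pow_add, ← pow_add, ← two_mul_choose_two]
    congr 2
    ring
  · simp [qPochInfR]

/-- A pair of natural numbers is determined by its difference and its minimum. -/
def subMinEquiv : ℕ × ℕ ≃ ℤ × ℕ where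
  toFun x := ((x.1 : ℤ) - x.2, min x.1 x.2)
  invFun x := (x.2 + x.1.toNat, x.2 + (-x.1).toNat)
  left_inv x := by ext <;> simp <;> omega
  right_inv x := by ext <;> simp; omega

theorem subMinEquiv_symm_natCast (m k : ℕ) : subMinEquiv.symm ((m : ℤ), k) = (k + m, k) := by
  simp [subMinEquiv]

theorem subMinEquiv_symm_neg_natCast (m k : ℕ) :
    subMinEquiv.symm (-(m : ℤ), k) = (k, k + m) := by
  simp [subMinEquiv]

/-- The Jacobi triple product identity. -/
theorem hasSum_jacobi {p y : ℝ} (hp0 : 0 < p) (hp1 : p < 1) (hy : 0 < y) :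
    HasSum (fun n : ℤ => p ^ ((n : ℝ) ^ 2) * y ^ (n : ℝ))
      (qPochInfR (-(p * y)) (p ^ 2) * qPochInfR (-(p / y)) (p ^ 2) *
        qPochInfR (p ^ 2) (p ^ 2)) := by
  have hP0 : 0 < p ^ 2 := pow_pos hp0 2
  have hP1 : p ^ 2 < 1 := pow_lt_one₀ hp0.le hp1 two_ne_zero
  have hE : ∀ z : ℝ, 0 < z → HasSum (fun i : ℕ => p ^ (i ^ 2) * z ^ i / qPochFinR (p ^ 2) (p ^ 2) i)
      (qPochInfR (-(p * z)) (p ^ 2)) := fun z hz => by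
    convert hasSum_euler hP0 hP1 (mul_pos hp0 hz).le using 3 with i
    rw [mul_pow, ← mul_assoc, ← pow_mul, ← pow_add, two_mul_choose_two]
  have h1 := hE y hy
  have h2 := hE y⁻¹ (inv_pos.2 hy)
  have hnn : ∀ z : ℝ, 0 < z →
      (0 : ℕ → ℝ) ≤ fun i => p ^ (i ^ 2) * z ^ i / qPochFinR (p ^ 2) (p ^ 2) i := fun z hz i => by
    have := qPochFinR_pos hP0 hP1 hP1 i
    simp only [Pi.zero_apply]
    positivity
  have h3 := h1.mul h2 (h1.summable.mul_of_nonneg h2.summable (hnn y hy) (hnn _ (inv_pos.2 hy)))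
  rw [← subMinEquiv.symm.hasSum_iff] at h3
  have hne := (qPochInfR_pos hP0 hP1 hP1).ne'
  have h4 := (h3.prod_fiberwise (g := fun n : ℤ => p ^ ((n : ℝ) ^ 2) * y ^ (n : ℝ) *
    (1 / qPochInfR (p ^ 2) (p ^ 2))) fun n => ?_).mul_right (qPochInfR (p ^ 2) (p ^ 2))
  · refine h4.congr_of_eq (fun n => ?_) rfl
    field_simp
  · obtain ⟨m, rfl | rfl⟩ := n.eq_nat_or_neg
    all_goals
      refine ((hasSum_durfee hP0 hP1 m).mul_left _).congr_fun fun k => ?_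
      simp only [Function.comp_apply, subMinEquiv_symm_natCast, subMinEquiv_symm_neg_natCast]
      have e : p ^ ((m : ℝ) ^ 2) = p ^ (m ^ 2) := by
        rw [← Real.rpow_natCast p, Nat.cast_pow]
      push_cast
      simp only [neg_sq, Real.rpow_neg hy.le, Real.rpow_natCast, e]
      rw [← pow_mul, inv_pow, pow_add y]
      have := (qPochFinR_pos hP0 hP1 hP1 k).ne'
      have := (qPochFinR_pos hP0 hP1 hP1 (k + m)).ne'
      field_simp
      ring

end JacobiTripleProduct

theorem HasSum.int_even_add_odd {α : Type*} [AddCommMonoid α] [TopologicalSpace α]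
    [ContinuousAdd α] {f : ℤ → α} {a b : α} (he : HasSum (fun n => f (2 * n)) a)
    (ho : HasSum (fun n => f (2 * n + 1)) b) : HasSum f (a + b) := by
  have hinj := mul_right_injective₀ (two_ne_zero' ℤ)
  replace ho := ((add_left_injective 1).comp hinj).hasSum_range_iff.2 ho
  refine (hinj.hasSum_range_iff.2 he).add_isCompl ?_ ho
  simpa [Function.comp_def] using Int.isCompl_even_odd

section DoubleSum

variable {q : ℝ}

theorem pow_four_pow (q : ℝ) (n : ℕ) : (q ^ 4) ^ n = q ^ (4 * (n : ℝ)) := by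
  rw [← pow_mul, ← Real.rpow_natCast]
  push_cast
  rfl

theorem cast_choose_two_eq (n : ℕ) : ((n.choose 2 : ℕ) : ℝ) = ((n : ℝ) ^ 2 - n) / 2 := by
  have := two_mul_choose_two n
  have h : 2 * ((n.choose 2 : ℕ) : ℝ) + n = (n : ℝ) ^ 2 := by exact_mod_cast this
  linarith

/-- The sum over the third index, as a function of the sum `s` of the first two. -/
noncomputable def innerSum (q s : ℝ) : ℝ := q ^ (s ^ 2) * qPochInfR (-(q ^ (4 - 2 * s))) (q ^ 4)

/-- The sum over pairs with difference `s`, up to a constant. -/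
noncomputable def fiberSum (q s : ℝ) : ℝ := innerSum q s * qPochInfR (-(q ^ (4 + 2 * s))) (q ^ 4)

/-- The product side of the symmetrized `fiberSum`. -/
noncomputable def thetaProd (q s : ℝ) : ℝ :=
  q ^ (s ^ 2 - s) * qPochInfR (-(q ^ (4 - 2 * s))) (q ^ 4) * qPochInfR (-(q ^ (2 * s))) (q ^ 4)

theorem hasSum_innerSum (hq0 : 0 < q) (hq1 : q < 1) (s : ℝ) :
    HasSum (fun k : ℕ => q ^ (s ^ 2 + 2 * (k : ℝ) ^ 2 - 2 * s * k + 2 * k) /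
      qPochFinR (q ^ 4) (q ^ 4) k) (innerSum q s) := by
  have h := (hasSum_euler (pow_pos hq0 4) (pow_lt_one₀ hq0.le hq1 four_ne_zero)
    (Real.rpow_pos_of_pos hq0 (4 - 2 * s)).le).mul_left (q ^ (s ^ 2))
  refine h.congr_of_eq (fun k => ?_) rfl
  rw [pow_four_pow q, cast_choose_two_eq, ← Real.rpow_mul_natCast hq0.le, ← Real.rpow_add hq0,
    ← mul_div_assoc, ← Real.rpow_add hq0]
  ring_nf

theorem qPochInfR_neg_rpow (hq0 : 0 < q) (hq1 : q < 1) (s : ℝ) :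
    qPochInfR (-(q ^ s)) (q ^ 4) = (1 + q ^ s) * qPochInfR (-(q ^ (s + 4))) (q ^ 4) := by
  rw [qPochInfR_eq_mul (pow_pos hq0 4) (pow_lt_one₀ hq0.le hq1 four_ne_zero), Real.rpow_add hq0,
    sub_neg_eq_add, neg_mul]
  norm_cast

theorem qPochInfR_neg_rpow_pos (hq0 : 0 < q) (hq1 : q < 1) (s : ℝ) :
    0 < qPochInfR (-(q ^ s)) (q ^ 4) :=
  qPochInfR_pos (pow_pos hq0 4) (pow_lt_one₀ hq0.le hq1 four_ne_zero)
    (by linarith [Real.rpow_pos_of_pos hq0 s])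

theorem innerSum_add_two (hq0 : 0 < q) (hq1 : q < 1) (s : ℝ) :
    innerSum q (s + 2) = q ^ (2 * s + 4) * (1 + q ^ (2 * s)) * innerSum q s := by
  have e : (1 + q ^ (-2 * s)) * q ^ (2 * s) = 1 + q ^ (2 * s) := by
    rw [add_mul, ← Real.rpow_add hq0, one_mul, add_comm]
    norm_num
  rw [innerSum, innerSum, show 4 - 2 * (s + 2) = -2 * s by ring, qPochInfR_neg_rpow hq0 hq1,
    ← e, show (s + 2) ^ 2 = (2 * s + 4) + 2 * s + s ^ 2 by ring, Real.rpow_add hq0,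
    Real.rpow_add hq0, show -2 * s + 4 = 4 - 2 * s by ring]
  ring

theorem innerSum_add_two_mul (hq0 : 0 < q) (hq1 : q < 1) (s : ℝ) (k : ℕ) :
    innerSum q (s + 2 * k) = innerSum q s * ((∏ l ∈ range k, (1 + q ^ (2 * s) * (q ^ 4) ^ l)) *
      (q ^ 4) ^ k.choose 2 * (q ^ (2 * s + 4)) ^ k) := by
  induction k with
  | zero => simp
  | succ k ih =>
    rw [Nat.cast_succ, show s + 2 * ((k : ℝ) + 1) = s + 2 * k + 2 by ring,
      innerSum_add_two hq0 hq1, ih, prod_range_succ, choose_two_succ, pow_add (q ^ 4), pow_succ,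
      show 2 * (s + 2 * (k : ℝ)) + 4 = (2 * s + 4) + 4 * k by ring,
      show 2 * (s + 2 * (k : ℝ)) = 2 * s + 4 * k by ring, Real.rpow_add hq0 (2 * s + 4),
      Real.rpow_add hq0 (2 * s) (4 * k), ← pow_four_pow q]
    ring

theorem hasSum_fiberSum (hq0 : 0 < q) (hq1 : q < 1) (m : ℕ) :
    HasSum (fun k : ℕ => innerSum q (m + 2 * k) /
      (qPochFinR (q ^ 4) (q ^ 4) k * qPochFinR (q ^ 4) (q ^ 4) (k + m)))
      (fiberSum q m / qPochInfR (q ^ 4) (q ^ 4)) := by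
  have h := (hasSum_phiTerm_shift (pow_pos hq0 4) (pow_lt_one₀ hq0.le hq1 four_ne_zero)
    zero_le_one (Real.rpow_pos_of_pos hq0 (2 * (m : ℝ))).le
    (Real.rpow_pos_of_pos hq0 (2 * (m : ℝ) + 4)).le (m := m) ?_).mul_left (innerSum q m)
  · refine h.congr_of_eq (fun k => ?_) ?_
    · rw [innerSum_add_two_mul hq0 hq1, mul_div_assoc]
    · rw [fiberSum, one_mul, mul_div_assoc, add_comm (4 : ℝ)]
  · rw [← Real.rpow_add hq0, pow_four_pow q]
    push_cast
    ring_nf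

theorem fiberSum_neg (q s : ℝ) : fiberSum q (-s) = fiberSum q s := by
  simp only [fiberSum, innerSum, neg_sq, mul_neg, sub_neg_eq_add, ← sub_eq_add_neg]
  ring

theorem fiberSum_pos (hq0 : 0 < q) (hq1 : q < 1) (s : ℝ) : 0 < fiberSum q s :=
  mul_pos (mul_pos (Real.rpow_pos_of_pos hq0 _) (qPochInfR_neg_rpow_pos hq0 hq1 _))
    (qPochInfR_neg_rpow_pos hq0 hq1 _)

theorem rpow_add_rpow_neg_mul_fiberSum (hq0 : 0 < q) (hq1 : q < 1) (s : ℝ) :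
    (q ^ s + q ^ (-s)) * fiberSum q s = thetaProd q s := by
  have e : q ^ s + q ^ (-s) = q ^ (-s) * (1 + q ^ (2 * s)) := by
    rw [mul_add, ← Real.rpow_add hq0, mul_one, add_comm]
    ring_nf
  rw [e, fiberSum, innerSum, thetaProd, qPochInfR_neg_rpow hq0 hq1 (2 * s), sub_eq_add_neg (s ^ 2),
    Real.rpow_add hq0 (s ^ 2), add_comm (4 : ℝ)]
  ring

theorem periodic_thetaProd (hq0 : 0 < q) (hq1 : q < 1) :
    Function.Periodic (fun s => q ^ (-(s ^ 2 / 2)) * thetaProd q s) 2 := fun s => by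
  have e : q ^ (2 * s) * (1 + q ^ (-2 * s)) = 1 + q ^ (2 * s) := by
    rw [mul_add, ← Real.rpow_add hq0, mul_one, add_comm]
    norm_num
  have e' : q ^ (-((s + 2) ^ 2 / 2)) * q ^ ((s + 2) ^ 2 - (s + 2)) =
      q ^ (-(s ^ 2 / 2)) * q ^ (s ^ 2 - s) * q ^ (2 * s) := by
    simp only [← Real.rpow_add hq0]
    ring_nf
  simp only [thetaProd]
  rw [show 4 - 2 * (s + 2) = -2 * s by ring, qPochInfR_neg_rpow hq0 hq1 (-2 * s),
    qPochInfR_neg_rpow hq0 hq1 (2 * s), ← e, show -2 * s + 4 = 4 - 2 * s by ring,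
    show 2 * (s + 2) = 2 * s + 4 by ring, ← mul_assoc, ← mul_assoc, e']
  ring

theorem thetaProd_eq (hq0 : 0 < q) (hq1 : q < 1) (s : ℝ) (n : ℤ) :
    thetaProd q (2 * n + s) = q ^ (2 * (n : ℝ) ^ 2 + 2 * n * s) * thetaProd q s := by
  have h := (periodic_thetaProd hq0 hq1).int_mul n s
  have e : q ^ (2 * (n : ℝ) ^ 2 + 2 * n * s) =
      q ^ ((s + n * 2) ^ 2 / 2) * q ^ (-(s ^ 2 / 2)) := by
    rw [← Real.rpow_add hq0]
    ring_nf
  rw [e, mul_assoc, ← h, ← mul_assoc, ← Real.rpow_add hq0]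
  ring_nf
  simp

theorem thetaProd_zero (hq0 : 0 < q) (hq1 : q < 1) :
    thetaProd q 0 = 2 * qPochInfR (-(q ^ 4)) (q ^ 4) ^ 2 := by
  have h := qPochInfR_neg_rpow hq0 hq1 0
  norm_num at h
  norm_num [thetaProd, h]
  ring

theorem thetaProd_one (q : ℝ) :
    thetaProd q 1 = qPochInfR (-(q ^ 2)) (q ^ 4) ^ 2 := by
  norm_num [thetaProd]
  ring

theorem hasSum_thetaProd (hq0 : 0 < q) (hq1 : q < 1) {c p : ℝ} (hc : 0 < c)
    (hp : p = q ^ (4 * c + 2)) :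
    HasSum (fun n : ℤ => q ^ (c * (n : ℝ) ^ 2) * thetaProd q n)
      (2 * (qPochInfR (-(q ^ 4)) (q ^ 4) ^ 2 *
          (qPochInfR (-p) (p ^ 2) ^ 2 * qPochInfR (p ^ 2) (p ^ 2)) +
        q ^ c * qPochInfR (-(q ^ 2)) (q ^ 4) ^ 2 *
          (qPochInfR (-(p ^ 2)) (p ^ 2) ^ 2 * qPochInfR (p ^ 2) (p ^ 2)))) := by
  have hp0 : 0 < p := by rw [hp]; exact Real.rpow_pos_of_pos hq0 _
  have hp1 : p < 1 := by rw [hp]; exact Real.rpow_lt_one hq0.le hq1 (by linarith)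
  have h0 := (hasSum_jacobi hp0 hp1 zero_lt_one).mul_left (thetaProd q 0)
  have h1 := (hasSum_jacobi hp0 hp1 hp0).mul_left (q ^ c * thetaProd q 1)
  have hpr : ∀ x : ℝ, p ^ x = q ^ ((4 * c + 2) * x) := fun x => by rw [hp, Real.rpow_mul hq0.le]
  have he := h0.congr_of_eq
      (g := fun n : ℤ => q ^ (c * ((2 * n : ℤ) : ℝ) ^ 2) * thetaProd q ((2 * n : ℤ) : ℝ))
      (fun n => by
    have := thetaProd_eq hq0 hq1 0 n
    rw [add_zero] at this
    push_cast
    rw [this, Real.one_rpow, hpr, mul_one, mul_comm (thetaProd q 0), ← mul_assoc,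
      ← Real.rpow_add hq0]
    ring_nf) rfl
  have ho := h1.congr_of_eq
      (g := fun n : ℤ => q ^ (c * ((2 * n + 1 : ℤ) : ℝ) ^ 2) * thetaProd q ((2 * n + 1 : ℤ) : ℝ))
      (fun n => by
    push_cast
    rw [thetaProd_eq hq0 hq1 1 n, hpr, hpr, ← Real.rpow_add hq0, mul_right_comm (q ^ c),
      ← mul_assoc, ← Real.rpow_add hq0, ← Real.rpow_add hq0]
    ring_nf) rfl
  refine (HasSum.int_even_add_odd (f := fun n : ℤ => q ^ (c * (n : ℝ) ^ 2) * thetaProd q n)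
    he ho).congr_of_eq (fun _ => rfl) ?_
  have h2 : qPochInfR (-1) (p ^ 2) = 2 * qPochInfR (-(p ^ 2)) (p ^ 2) := by
    rw [qPochInfR_eq_mul (pow_pos hp0 2) (pow_lt_one₀ hp0.le hp1 two_ne_zero)]
    norm_num
  rw [thetaProd_zero hq0 hq1, thetaProd_one, div_self hp0.ne', h2, mul_one, div_one, ← pow_two p]
  ring

theorem hasSum_fiberSum_int (hq0 : 0 < q) (hq1 : q < 1) {c a : ℝ}
    (h : HasSum (fun n : ℤ => q ^ (c * (n : ℝ) ^ 2) * thetaProd q n) (2 * a)) :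
    HasSum (fun n : ℤ => q ^ (c * (n : ℝ) ^ 2 + n) * fiberSum q n) a := by
  have hpos : ∀ x : ℝ, 0 < q ^ x := Real.rpow_pos_of_pos hq0
  have hsplit : ∀ n : ℤ, q ^ (c * (n : ℝ) ^ 2) * thetaProd q n =
      q ^ (c * (n : ℝ) ^ 2 + n) * fiberSum q n +
        q ^ (c * ((-n : ℤ) : ℝ) ^ 2 + (-n : ℤ)) * fiberSum q (-n : ℤ) := fun n => by
    push_cast
    rw [← rpow_add_rpow_neg_mul_fiberSum hq0 hq1, fiberSum_neg, neg_sq, Real.rpow_add hq0,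
      Real.rpow_add hq0]
    ring
  have hnn : ∀ n : ℤ, 0 ≤ q ^ (c * (n : ℝ) ^ 2 + n) * fiberSum q n := fun n =>
    (mul_pos (hpos _) (fiberSum_pos hq0 hq1 _)).le
  have hs : Summable fun n : ℤ => q ^ (c * (n : ℝ) ^ 2 + n) * fiberSum q n :=
    Summable.of_nonneg_of_le hnn
      (fun n => by rw [hsplit]; exact le_add_of_nonneg_right (hnn (-n))) h.summable
  have h2 := hs.hasSum.add ((Equiv.neg ℤ).hasSum_iff.2 hs.hasSum)
  have h3 := h.unique (h2.congr_of_eq hsplit rfl)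
  have : a = ∑' n : ℤ, q ^ (c * (n : ℝ) ^ 2 + n) * fiberSum q n := by linarith
  exact this ▸ hs.hasSum

theorem hasSum_pairs (hq0 : 0 < q) (hq1 : q < 1) {c a : ℝ}
    (h : HasSum (fun n : ℤ => q ^ (c * (n : ℝ) ^ 2 + n) * fiberSum q n) a) :
    HasSum (fun x : ℕ × ℕ => q ^ (c * ((x.1 : ℝ) - x.2) ^ 2 + (x.1 - x.2)) *
      (innerSum q (x.1 + x.2) /
        (qPochFinR (q ^ 4) (q ^ 4) x.1 * qPochFinR (q ^ 4) (q ^ 4) x.2)))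
      (a / qPochInfR (q ^ 4) (q ^ 4)) := by
  have hQ0 := pow_pos hq0 4
  have hQ1 := pow_lt_one₀ hq0.le hq1 four_ne_zero
  set f : ℕ × ℕ → ℝ := fun x => q ^ (c * ((x.1 : ℝ) - x.2) ^ 2 + (x.1 - x.2)) *
      (innerSum q (x.1 + x.2) /
        (qPochFinR (q ^ 4) (q ^ 4) x.1 * qPochFinR (q ^ 4) (q ^ 4) x.2)) with hf
  have hnn : 0 ≤ f ∘ subMinEquiv.symm := fun x => by
    have h1 := qPochFinR_pos hQ0 hQ1 hQ1 (subMinEquiv.symm x).1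
    have h2 := qPochFinR_pos hQ0 hQ1 hQ1 (subMinEquiv.symm x).2
    exact mul_nonneg (Real.rpow_pos_of_pos hq0 _).le (div_nonneg
      (mul_pos (Real.rpow_pos_of_pos hq0 _) (qPochInfR_neg_rpow_pos hq0 hq1 _)).le
      (mul_pos h1 h2).le)
  have hfib : ∀ n : ℤ, HasSum (fun k => (f ∘ subMinEquiv.symm) (n, k))
      (q ^ (c * (n : ℝ) ^ 2 + n) * fiberSum q n / qPochInfR (q ^ 4) (q ^ 4)) := fun n => by
    obtain ⟨m, rfl | rfl⟩ := n.eq_nat_or_neg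
    · refine ((hasSum_fiberSum hq0 hq1 m).mul_left (q ^ (c * (m : ℝ) ^ 2 + m))).congr_of_eq
        (fun k => ?_) ?_
      · simp only [Function.comp_apply, subMinEquiv_symm_natCast, hf]
        push_cast
        ring_nf
      · push_cast
        ring
    · refine ((hasSum_fiberSum hq0 hq1 m).mul_left (q ^ (c * (m : ℝ) ^ 2 - m))).congr_of_eq
        (fun k => ?_) ?_
      · simp only [Function.comp_apply, subMinEquiv_symm_neg_natCast, hf]
        push_cast
        ring_nf
      · push_cast
        rw [fiberSum_neg, neg_sq, ← sub_eq_add_neg]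
        ring
  have hs : Summable (f ∘ subMinEquiv.symm) := by
    refine (summable_prod_of_nonneg hnn).2 ⟨fun n => (hfib n).summable, ?_⟩
    simp only [(hfib _).tsum_eq]
    exact h.summable.div_const _
  rw [← subMinEquiv.symm.hasSum_iff, (h.div_const _).unique (hs.hasSum.prod_fiberwise hfib)]
  exact hs.hasSum

theorem qPochInfR_neg_self (hq0 : 0 < q) (hq1 : q < 1) :
    qPochInfR (-q) q = qPochInfR (q ^ 2) (q ^ 2) / qPochInfR q q := by
  rw [eq_div_iff (qPochInfR_pos hq0 hq1 hq1).ne', mul_comm, qPochInfR_mul_neg hq0 hq1]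

theorem qPochInfR_neg_self_sq (hq0 : 0 < q) (hq1 : q < 1) :
    qPochInfR (-q) (q ^ 2) = qPochInfR (q ^ 2) (q ^ 2) ^ 2 /
      (qPochInfR q q * qPochInfR (q ^ 4) (q ^ 4)) := by
  have hp : ∀ {n : ℕ}, n ≠ 0 → 0 < qPochInfR (q ^ n) (q ^ n) := fun {n} hn =>
    have h := pow_lt_one₀ hq0.le hq1 hn
    qPochInfR_pos (pow_pos hq0 n) h h
  have h1 := qPochInfR_sq_mul hq0 hq1 q
  have h2 := qPochInfR_sq_mul (pow_pos hq0 2) (pow_lt_one₀ hq0.le hq1 two_ne_zero) (q ^ 2)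
  have h3 := qPochInfR_mul_neg (pow_pos hq0 2) (pow_lt_one₀ hq0.le hq1 two_ne_zero) q
  rw [← pow_two q] at h1
  have e : q ^ 2 * q ^ 2 = q ^ 4 := by ring
  have e' : (q ^ 2) ^ 2 = q ^ 4 := by ring
  rw [e, e'] at h2
  rw [e'] at h3
  have n1 : qPochInfR q q ≠ 0 := by simpa using (hp one_ne_zero).ne'
  have n4 := (hp four_ne_zero).ne'
  rw [eq_div_iff (mul_ne_zero n1 n4), ← h1]
  calc _ = qPochInfR q (q ^ 2) * qPochInfR (-q) (q ^ 2) * qPochInfR (q ^ 4) (q ^ 4) *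
        qPochInfR (q ^ 2) (q ^ 2) := by ring
    _ = _ := by rw [h3, h2]; ring

end DoubleSum

theorem stmt4 (q : ℝ) (hq0 : 0 < q) (hq1 : q < 1) (m : ℚ) (hm : 0 < m) :
    (∑' (i : ℕ) (j : ℕ) (k : ℕ),
      q ^ (2*(m:ℝ)*((i:ℝ)-(j:ℝ))^2 + ((i:ℝ)+(j:ℝ))^2 + 2*(k:ℝ)^2
            - 2*((i:ℝ)+(j:ℝ))*(k:ℝ) + (i:ℝ) - (j:ℝ) + 2*(k:ℝ)) /
        (qPochFinR (q ^ (4:ℕ)) (q ^ (4:ℕ)) i * qPochFinR (q ^ (4:ℕ)) (q ^ (4:ℕ)) j *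
          qPochFinR (q ^ (4:ℕ)) (q ^ (4:ℕ)) k)) =
    JR q 8 ^ 2 * JbarR q (8*(m:ℝ)+2) (16*(m:ℝ)+4) / JR q 4 ^ 3
    + q ^ (2*(m:ℝ)) * JR q 4 ^ 3 * JR q (32*(m:ℝ)+8) ^ 2 /
        (JR q 2 ^ 2 * JR q 8 ^ 2 * JR q (16*(m:ℝ)+4)) := by
  have hm' : (0 : ℝ) < m := by exact_mod_cast hm
  have hpow : ∀ n : ℕ, n ≠ 0 → 0 < q ^ n ∧ q ^ n < 1 := fun n hn =>
    ⟨pow_pos hq0 n, pow_lt_one₀ hq0.le hq1 hn⟩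
  obtain ⟨hQ0, hQ1⟩ := hpow 4 four_ne_zero
  obtain ⟨h20, h21⟩ := hpow 2 two_ne_zero
  have hsum := hasSum_pairs hq0 hq1 (hasSum_fiberSum_int hq0 hq1
    (hasSum_thetaProd hq0 hq1 (mul_pos two_pos hm') rfl))
  have hk : ∀ i j : ℕ, ∑' k : ℕ, q ^ (2*(m:ℝ)*((i:ℝ)-(j:ℝ))^2 + ((i:ℝ)+(j:ℝ))^2 + 2*(k:ℝ)^2
            - 2*((i:ℝ)+(j:ℝ))*(k:ℝ) + (i:ℝ) - (j:ℝ) + 2*(k:ℝ)) /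
        (qPochFinR (q ^ 4) (q ^ 4) i * qPochFinR (q ^ 4) (q ^ 4) j *
          qPochFinR (q ^ 4) (q ^ 4) k) =
      q ^ (2 * (m : ℝ) * ((i : ℝ) - j) ^ 2 + (i - j)) * (innerSum q (i + j) /
        (qPochFinR (q ^ 4) (q ^ 4) i * qPochFinR (q ^ 4) (q ^ 4) j)) := fun i j => by
    refine (((hasSum_innerSum hq0 hq1 (i + j)).div_const (qPochFinR (q ^ 4) (q ^ 4) i *
      qPochFinR (q ^ 4) (q ^ 4) j)).mul_left (q ^ (2 * (m : ℝ) * ((i : ℝ) - j) ^ 2 +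
        (i - j)))).congr_of_eq (fun k => ?_) rfl |>.tsum_eq
    rw [div_div, ← mul_div_assoc, ← Real.rpow_add hq0, mul_comm (qPochFinR _ _ k)]
    ring_nf
  simp only [hk]
  rw [← hsum.summable.tsum_prod' hsum.summable.prod_factor, hsum.tsum_eq]
  obtain ⟨p, hp⟩ : ∃ p, p = q ^ (4 * (2 * (m : ℝ)) + 2) := ⟨_, rfl⟩
  have hp0 : 0 < p := by rw [hp]; exact Real.rpow_pos_of_pos hq0 _
  have hp1 : p < 1 := by rw [hp]; exact Real.rpow_lt_one hq0.le hq1 (by linarith)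
  have hP0 : 0 < p ^ 2 := pow_pos hp0 2
  have hP1 : p ^ 2 < 1 := pow_lt_one₀ hp0.le hp1 two_ne_zero
  have e1 : q ^ (8 * (m : ℝ) + 2) = p := by rw [hp]; ring_nf
  have e2 : q ^ (16 * (m : ℝ) + 4) = p ^ 2 := by
    rw [hp, ← Real.rpow_mul_natCast hq0.le]; push_cast; ring_nf
  have e4 : q ^ (32 * (m : ℝ) + 8) = (p ^ 2) ^ 2 := by
    rw [← pow_mul, hp, ← Real.rpow_mul_natCast hq0.le]; push_cast; ring_nf
  have e5 : q ^ (16 * (m : ℝ) + 4 - (8 * (m : ℝ) + 2)) = p := by rw [hp]; ring_nf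
  have f2 : q ^ (2 : ℝ) = q ^ 2 := by norm_cast
  have f4 : q ^ (4 : ℝ) = q ^ 4 := by norm_cast
  have f8 : q ^ (8 : ℝ) = q ^ 8 := by norm_cast
  have g8 : (q ^ 4) ^ 2 = q ^ 8 := by ring
  have g4 : (q ^ 2) ^ 2 = q ^ 4 := by ring
  have g8' : (q ^ 2) ^ 4 = q ^ 8 := by ring
  have k4 := qPochInfR_neg_self hQ0 hQ1
  have k2 := qPochInfR_neg_self_sq h20 h21
  rw [g8] at k4
  rw [g4, g8'] at k2
  have n2 := (qPochInfR_pos h20 h21 h21).ne'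
  have n4 := (qPochInfR_pos hQ0 hQ1 hQ1).ne'
  have n8 := (hpow 8 (by norm_num)).elim fun h0 h1 => (qPochInfR_pos h0 h1 h1).ne'
  have nP := (qPochInfR_pos hP0 hP1 hP1).ne'
  simp only [JR, JbarR, e1, e2, e4, e5, f2, f4, f8, ← hp]
  rw [k4, k2, qPochInfR_neg_self hP0 hP1]
  field_simp
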